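/- arXiv:0807.1002 — 2 statements merged into one kernel-verified Lean document; each statement's English description precedes it below -/
import Mathlib

section
/- Let M be a model category with class of weak equivalences W, and let A and X be objects of M that are both fibrant and cofibrant. Then the localization functor γ : M → Ho(M) := M[W⁻¹] induces a bijection π(A,X) ≅ Hom_{Ho(M)}(γA, γX), i.e. two morphisms f, g : A → X have equal images under γ if and only if they are homotopic, and every morphism γA → γX in Ho(M) is the image of some morphism A → X in M. -/
open CategoryTheory Limits

universe v u

/-- A class of morphisms is closed under retracts. -/
def RetractClosed {M : Type u} [Category.{v} M] (P : MorphismProperty M) : Prop :=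
  ∀ {X Y X' Y' : M} (f : X ⟶ Y) (g : X' ⟶ Y')
    (iX : X ⟶ X') (rX : X' ⟶ X) (iY : Y ⟶ Y') (rY : Y' ⟶ Y),
    iX ≫ rX = 𝟙 X → iY ≫ rY = 𝟙 Y → iX ≫ g = f ≫ iY → g ≫ rY = rX ≫ f →
    P g → P f

/-- A (Quillen) model structure on a category `M`: finite limits and colimits, plus
classes `W` (weak equivalences), `Fib` (fibrations) and `Cof` (cofibrations)
satisfying Quillen's axioms. -/
structure ModelStructure (M : Type u) [Category.{v} M] where
  hasFiniteLimits : HasFiniteLimits M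
  hasFiniteColimits : HasFiniteColimits M
  W : MorphismProperty M
  Fib : MorphismProperty M
  Cof : MorphismProperty M
  id_mem : ∀ X : M, W (𝟙 X) ∧ Fib (𝟙 X) ∧ Cof (𝟙 X)
  twoOfThree₁ : ∀ {X Y Z : M} (f : X ⟶ Y) (g : Y ⟶ Z), W f → W g → W (f ≫ g)
  twoOfThree₂ : ∀ {X Y Z : M} (f : X ⟶ Y) (g : Y ⟶ Z), W f → W (f ≫ g) → W g
  twoOfThree₃ : ∀ {X Y Z : M} (f : X ⟶ Y) (g : Y ⟶ Z), W g → W (f ≫ g) → W f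
  retractW : RetractClosed W
  retractFib : RetractClosed Fib
  retractCof : RetractClosed Cof
  lifting : ∀ {A B X Y : M} (i : A ⟶ B) (p : X ⟶ Y), Cof i → Fib p → (W i ∨ W p) →
    ∀ (f : A ⟶ X) (g : B ⟶ Y), f ≫ p = i ≫ g → ∃ h : B ⟶ X, i ≫ h = f ∧ h ≫ p = g
  factTrivCofFib : ∀ {X Y : M} (f : X ⟶ Y),
    ∃ (Z : M) (i : X ⟶ Z) (p : Z ⟶ Y), Cof i ∧ W i ∧ Fib p ∧ i ≫ p = f
  factCofTrivFib : ∀ {X Y : M} (f : X ⟶ Y),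
    ∃ (Z : M) (i : X ⟶ Z) (p : Z ⟶ Y), Cof i ∧ Fib p ∧ W p ∧ i ≫ p = f

/-- An object is cofibrant if the unique map from an initial object to it is a cofibration. -/
def ModelStructure.Cofibrant {M : Type u} [Category.{v} M] (S : ModelStructure M) (A : M) : Prop :=
  ∃ (O : M) (h : IsInitial O), S.Cof (h.to A)

/-- An object is fibrant if the unique map from it to a terminal object is a fibration. -/
def ModelStructure.Fibrant {M : Type u} [Category.{v} M] (S : ModelStructure M) (X : M) : Prop :=
  ∃ (T : M) (h : IsTerminal T), S.Fib (h.from X)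

/-- The (left/right) homotopy relation of the paper: `f ∼ g` iff there are `I`,
`i₀ i₁ : A ⟶ I`, `p : I ⟶ A` with `p` a weak equivalence, `i₀ ≫ p = 𝟙 A = i₁ ≫ p`,
and `H : I ⟶ X` with `i₀ ≫ H = f` and `i₁ ≫ H = g`. -/
def ModelStructure.Homotopic {M : Type u} [Category.{v} M] (S : ModelStructure M)
    {A X : M} (f g : A ⟶ X) : Prop :=
  ∃ (I : M) (i₀ i₁ : A ⟶ I) (p : I ⟶ A) (H : I ⟶ X),
    S.W p ∧ i₀ ≫ p = 𝟙 A ∧ i₁ ≫ p = 𝟙 A ∧ i₀ ≫ H = f ∧ i₁ ≫ H = g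
lemma RetractClosed.isStable {M : Type u} [Category.{v} M] {P : MorphismProperty M}
    (h : RetractClosed P) : P.IsStableUnderRetracts where
  of_retract {_ _ _ _ f g} r hg :=
    h f g r.i.left r.r.left r.i.right r.r.right r.retract_left r.retract_right
      r.i_w r.r_w.symm hg

lemma ModelStructure.hasTwoOutOfThree {M : Type u} [Category.{v} M]
    (S : ModelStructure M) : S.W.HasTwoOutOfThreeProperty where
  comp_mem f g hf hg := S.twoOfThree₁ f g hf hg
  of_postcomp f g hg hfg := S.twoOfThree₃ f g hg hfg
  of_precomp f g hf hfg := S.twoOfThree₂ f g hf hfg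

/-- The Mathlib model category attached to a model structure. -/
@[reducible] def ModelStructure.toModelCategory {M : Type u} [Category.{v} M]
    (S : ModelStructure M) : HomotopicalAlgebra.ModelCategory M :=
  { categoryWithFibrations := ⟨S.Fib⟩
    categoryWithCofibrations := ⟨S.Cof⟩
    categoryWithWeakEquivalences := ⟨S.W⟩
    cm1a := S.hasFiniteLimits
    cm1b := S.hasFiniteColimits
    cm2 := S.hasTwoOutOfThree
    cm3a := RetractClosed.isStable (P := S.W) S.retractW
    cm3b := RetractClosed.isStable (P := S.Fib) S.retractFib
    cm3c := RetractClosed.isStable (P := S.Cof) S.retractCof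
    cm4a := fun i p hi hw hp => ⟨fun {f g} sq => by
      obtain ⟨h, h1, h2⟩ := S.lifting i p hi.mem hp.mem (Or.inl hw.mem) f g sq.w
      exact ⟨⟨⟨h, h1, h2⟩⟩⟩⟩
    cm4b := fun i p hi hp hw => ⟨fun {f g} sq => by
      obtain ⟨h, h1, h2⟩ := S.lifting i p hi.mem hp.mem (Or.inr hw.mem) f g sq.w
      exact ⟨⟨⟨h, h1, h2⟩⟩⟩⟩
    cm5a := ⟨fun f => by
      obtain ⟨Z, i, p, h1, h2, h3, h4⟩ := S.factTrivCofFib f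
      exact ⟨⟨Z, i, p, h4, ⟨h1, h2⟩, h3⟩⟩⟩
    cm5b := ⟨fun f => by
      obtain ⟨Z, i, p, h1, h2, h3, h4⟩ := S.factCofTrivFib f
      exact ⟨⟨Z, i, p, h4, h1, ⟨h2, h3⟩⟩⟩⟩ }

/-- for `A` and `X` both fibrant and cofibrant, the localization functor
`γ = S.W.Q : M ⥤ Ho(M) = M[W⁻¹]` identifies exactly homotopic morphisms `A ⟶ X`
and is surjective on morphisms `γA ⟶ γX`; i.e. it induces a bijection
`π(A, X) ≅ Hom_{Ho(M)}(γA, γX)`. -/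
theorem localization_hom_eq_homotopy_classes {M : Type u} [Category.{v} M]
    (S : ModelStructure M) {A X : M}
    (hA₁ : S.Fibrant A) (hA₂ : S.Cofibrant A) (hX₁ : S.Fibrant X) (hX₂ : S.Cofibrant X) :
    (∀ f g : A ⟶ X, S.W.Q.map f = S.W.Q.map g ↔ S.Homotopic f g) ∧
    (∀ φ : S.W.Q.obj A ⟶ S.W.Q.obj X, ∃ f : A ⟶ X, S.W.Q.map f = φ) := by
  let _ := S.toModelCategory
  have : HomotopicalAlgebra.IsCofibrant A := by
    obtain ⟨O, h, hc⟩ := hA₂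
    exact (HomotopicalAlgebra.isCofibrant_iff_of_isInitial _ h).2 ⟨hc⟩
  have : HomotopicalAlgebra.IsFibrant X := by
    obtain ⟨O, h, hc⟩ := hX₁
    exact (HomotopicalAlgebra.isFibrant_iff_of_isTerminal _ h).2 ⟨hc⟩
  have : S.W.Q.IsLocalization (HomotopicalAlgebra.weakEquivalences M) :=
    inferInstanceAs (S.W.Q.IsLocalization S.W)
  refine ⟨fun f g => ?_, HomotopicalAlgebra.map_surjective_of_isLocalization S.W.Q A X⟩
  rw [← HomotopicalAlgebra.LeftHomotopyRel.iff_map_eq S.W.Q]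
  constructor
  · rintro ⟨P, ⟨h⟩⟩
    exact ⟨P.I, P.i₀, P.i₁, P.π, h.h, P.weakEquivalence_π.mem, P.i₀_π, P.i₁_π, h.h₀, h.h₁⟩
  · rintro ⟨I, i₀, i₁, p, H, hp, h0, h1, h2, h3⟩
    exact ⟨{ I := I, i₀ := i₀, i₁ := i₁, π := p, i₀_π := h0, i₁_π := h1,
             weakEquivalence_π := ⟨hp⟩ }, ⟨⟨H, h2, h3⟩⟩⟩
end

section
/- Let U be an ultrafilter on a set ι, let (A i) be a family of abelian categories, and for each i let B i be a Serre class of objects of A i (a class containing the zero objects and such that for every short exact sequence 0 → A' → A → A'' → 0 in A i, A belongs to B i if and only if both A' and A'' belong to B i). Equip A := ∏_U A i with its germwise abelian structure, and define a class P of objects of A by: P((X i)) holds iff {i | X i ∈ B i} ∈ U. Then P is a Serre class of A: it contains the zero object, and for every short exact sequence 0 → X' → X → X'' → 0 in A, X satisfies P if and only if both X' and X'' satisfy P. -/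
open CategoryTheory Limits

universe w v u

/-- The setoid of `U`-almost-everywhere equality on the dependent product `∀ i, S i`. -/
def germSetoid {ι : Type u} (U : Ultrafilter ι) (S : ι → Type v) :
    Setoid (∀ i, S i) where
  r s t := {i | s i = t i} ∈ U
  iseqv := by
    constructor
    · intro s
      exact Filter.univ_mem' (fun i => rfl)
    · intro s t h
      exact Filter.mem_of_superset h (fun i hi => hi.symm)
    · intro s t u h₁ h₂
      exact Filter.mem_of_superset (Filter.inter_mem h₁ h₂) (fun i hi => hi.1.trans hi.2)

/-- The ultraproduct `∏_U S i` of a family of sets: the quotient of `∀ i, S i` by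
`U`-almost-everywhere equality. -/
def Ultraproduct {ι : Type u} (U : Ultrafilter ι) (S : ι → Type v) : Type (max u v) :=
  Quotient (germSetoid U S)

/-- The germ `[s]` of a family `s`. -/
def Ultraproduct.mk {ι : Type u} (U : Ultrafilter ι) {S : ι → Type v} (s : ∀ i, S i) :
    Ultraproduct U S :=
  Quotient.mk (germSetoid U S) s

/-- The ultraproduct category `∏_U C i`: objects are families of objects,
hom-sets are ultraproducts of hom-sets, with germwise composition and
germs of identities as identities. -/
def UltraCat {ι : Type u} (U : Ultrafilter ι) (C : ι → Type v)
    [∀ i, Category.{w} (C i)] : Type (max u v) :=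
  ∀ i, C i

set_option linter.unusedVariables false in
instance UltraCat.instCategory {ι : Type u} (U : Ultrafilter ι) (C : ι → Type v)
    [∀ i, Category.{w} (C i)] : Category.{max u w} (UltraCat U C) where
  Hom X Y := Ultraproduct U (fun i => X i ⟶ Y i)
  id X := Ultraproduct.mk U (fun i => 𝟙 (X i))
  comp {X Y Z} f g :=
    Quotient.liftOn₂ f g
      (fun f g => Ultraproduct.mk U (fun i => f i ≫ g i))
      (by
        intro a₁ a₂ b₁ b₂ h₁ h₂
        exact Quotient.sound (Filter.mem_of_superset (Filter.inter_mem h₁ h₂)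
          (fun i hi => by
            have e₁ : a₁ i = b₁ i := hi.1
            have e₂ : a₂ i = b₂ i := hi.2
            show a₁ i ≫ a₂ i = b₁ i ≫ b₂ i
            rw [e₁, e₂])))
  id_comp := by
    intro X Y f
    induction f using Quotient.inductionOn with
    | _ a => exact congrArg (Quotient.mk _) (funext fun i => Category.id_comp (a i))
  comp_id := by
    intro X Y f
    induction f using Quotient.inductionOn with
    | _ a => exact congrArg (Quotient.mk _) (funext fun i => Category.comp_id (a i))
  assoc := by
    intro W X Y Z f g h
    induction f using Quotient.inductionOn with
    | _ a =>
      induction g using Quotient.inductionOn with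
      | _ b =>
        induction h using Quotient.inductionOn with
        | _ c => exact congrArg (Quotient.mk _) (funext fun i => Category.assoc (a i) (b i) (c i))

/-- The morphism of the ultraproduct category determined by a family of morphisms. -/
def UltraCat.mkHom {ι : Type u} (U : Ultrafilter ι) {C : ι → Type v}
    [∀ i, Category.{w} (C i)] {X Y : UltraCat U C} (f : ∀ i, X i ⟶ Y i) : X ⟶ Y :=
  Ultraproduct.mk U f

/-- Germwise addition on an ultraproduct of abelian groups. -/
instance Ultraproduct.instAdd {ι : Type u} (U : Ultrafilter ι)
    (S : ι → Type v) [∀ i, AddCommGroup (S i)] : Add (Ultraproduct U S) where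
  add a b :=
    Quotient.liftOn₂ a b (fun f g => Ultraproduct.mk U (fun i => f i + g i))
      (by
        intro a₁ a₂ b₁ b₂ h₁ h₂
        exact Quotient.sound (Filter.mem_of_superset (Filter.inter_mem h₁ h₂)
          (fun i hi => by
            show a₁ i + a₂ i = b₁ i + b₂ i
            rw [show a₁ i = b₁ i from hi.1, show a₂ i = b₂ i from hi.2])))

/-- The germ of the zero family. -/
instance Ultraproduct.instZero {ι : Type u} (U : Ultrafilter ι)
    (S : ι → Type v) [∀ i, AddCommGroup (S i)] : Zero (Ultraproduct U S) where
  zero := Ultraproduct.mk U (fun _ => 0)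

/-- Germwise negation on an ultraproduct of abelian groups. -/
instance Ultraproduct.instNeg {ι : Type u} (U : Ultrafilter ι)
    (S : ι → Type v) [∀ i, AddCommGroup (S i)] : Neg (Ultraproduct U S) where
  neg a :=
    Quotient.liftOn a (fun f => Ultraproduct.mk U (fun i => -f i))
      (by
        intro a b h
        exact Quotient.sound (Filter.mem_of_superset h (fun i hi => by
          show -a i = -b i
          rw [show a i = b i from hi])))

/-- The germwise abelian group structure on an ultraproduct of abelian groups. -/
instance Ultraproduct.instAddCommGroup {ι : Type u} (U : Ultrafilter ι)
    (S : ι → Type v) [∀ i, AddCommGroup (S i)] : AddCommGroup (Ultraproduct U S) where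
  add := (· + ·)
  zero := 0
  neg := (- ·)
  add_assoc a b c := by
    induction a using Quotient.inductionOn with
    | _ f =>
      induction b using Quotient.inductionOn with
      | _ g =>
        induction c using Quotient.inductionOn with
        | _ h => exact congrArg (Quotient.mk _) (funext fun i => add_assoc (f i) (g i) (h i))
  zero_add a := by
    induction a using Quotient.inductionOn with
    | _ f => exact congrArg (Quotient.mk _) (funext fun i => zero_add (f i))
  add_zero a := by
    induction a using Quotient.inductionOn with
    | _ f => exact congrArg (Quotient.mk _) (funext fun i => add_zero (f i))
  neg_add_cancel a := by
    induction a using Quotient.inductionOn with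
    | _ f => exact congrArg (Quotient.mk _) (funext fun i => neg_add_cancel (f i))
  add_comm a b := by
    induction a using Quotient.inductionOn with
    | _ f =>
      induction b using Quotient.inductionOn with
      | _ g => exact congrArg (Quotient.mk _) (funext fun i => add_comm (f i) (g i))
  nsmul := nsmulRec
  zsmul := zsmulRec

/-- The germwise preadditive structure on an ultraproduct of preadditive categories. -/
instance UltraCat.instPreadditive {ι : Type u} (U : Ultrafilter ι) (C : ι → Type v)
    [∀ i, Category.{w} (C i)] [∀ i, Preadditive (C i)] :
    Preadditive (UltraCat U C) where
  homGroup P Q :=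
    @Ultraproduct.instAddCommGroup ι U (fun i => P i ⟶ Q i) (fun i => Preadditive.homGroup (P i) (Q i))
  add_comp P Q R f f' g := by
    induction f using Quotient.inductionOn with
    | _ a =>
      induction f' using Quotient.inductionOn with
      | _ a' =>
        induction g using Quotient.inductionOn with
        | _ b =>
          exact congrArg (Quotient.mk _)
            (funext fun i => Preadditive.add_comp _ _ _ (a i) (a' i) (b i))
  comp_add P Q R f g g' := by
    induction f using Quotient.inductionOn with
    | _ a =>
      induction g using Quotient.inductionOn with
      | _ b =>
        induction g' using Quotient.inductionOn with
        | _ b' =>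
          exact congrArg (Quotient.mk _)
            (funext fun i => Preadditive.comp_add _ _ _ (a i) (b i) (b' i))

/-- A Serre class in a preadditive category: a class of objects containing the zero
objects such that for every short exact sequence `0 ⟶ X' ⟶ X ⟶ X'' ⟶ 0` (encoded as:
`g` is an epimorphism and `f` is a kernel of `g`), the middle object belongs to the
class if and only if both outer objects do. -/
def IsSerreClass {A : Type*} [Category A] [Preadditive A] (P : A → Prop) : Prop :=
  (∀ Z : A, IsZero Z → P Z) ∧
  ∀ {X' X X'' : A} (f : X' ⟶ X) (g : X ⟶ X'') (w : f ≫ g = 0),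
    Epi g → Nonempty (IsLimit (KernelFork.ofι f w)) → (P X ↔ P X' ∧ P X'')

theorem UltraCat.mkHom_eq_iff {ι : Type u} (U : Ultrafilter ι) {C : ι → Type v}
    [∀ i, Category.{w} (C i)] {X Y : UltraCat U C} (f g : ∀ i, X i ⟶ Y i) :
    UltraCat.mkHom U f = UltraCat.mkHom U g ↔ {i | f i = g i} ∈ U :=
  ⟨fun h => Quotient.exact h, fun h => Quotient.sound h⟩

theorem UltraCat.mkHom_comp {ι : Type u} (U : Ultrafilter ι) {C : ι → Type v}
    [∀ i, Category.{w} (C i)] {X Y Z : UltraCat U C} (f : ∀ i, X i ⟶ Y i)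
    (g : ∀ i, Y i ⟶ Z i) :
    UltraCat.mkHom U f ≫ UltraCat.mkHom U g = UltraCat.mkHom U (fun i => f i ≫ g i) := rfl

theorem UltraCat.mkHom_eq_zero_iff {ι : Type u} (U : Ultrafilter ι) {C : ι → Type v}
    [∀ i, Category.{w} (C i)] [∀ i, Preadditive (C i)] {X Y : UltraCat U C}
    (f : ∀ i, X i ⟶ Y i) :
    UltraCat.mkHom U f = 0 ↔ {i | f i = 0} ∈ U :=
  UltraCat.mkHom_eq_iff U f (fun _ => 0)

theorem UltraCat.mkHom_surj {ι : Type u} (U : Ultrafilter ι) {C : ι → Type v}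
    [∀ i, Category.{w} (C i)] {X Y : UltraCat U C} (f : X ⟶ Y) :
    ∃ a : ∀ i, X i ⟶ Y i, f = UltraCat.mkHom U a := by
  obtain ⟨a, ha⟩ := Quotient.exists_rep f
  exact ⟨a, ha.symm⟩

/-- if `B i` is a Serre class of `A i` for each `i`, then the class of
objects of the (germwise abelian) ultraproduct `∏_U A i` whose components lie in `B i`
for `U`-almost all `i` is a Serre class. -/
theorem ultraCat_serreClass {ι : Type u} (U : Ultrafilter ι)
    (A : ι → Type v) [∀ i, Category.{w} (A i)] [∀ i, Abelian (A i)]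
    (B : ∀ i, A i → Prop) (hB : ∀ i, IsSerreClass (B i)) :
    IsSerreClass (fun X : UltraCat U A => {i | B i (X i)} ∈ U) := by
  constructor
  · intro Z hZ
    have h : UltraCat.mkHom U (fun i => 𝟙 (Z i)) = (0 : Z ⟶ Z) := hZ.eq_of_src _ _
    rw [UltraCat.mkHom_eq_zero_iff] at h
    exact Filter.mem_of_superset h fun i hi => (hB i).1 _ ((IsZero.iff_id_eq_zero _).2 hi)
  · intro X' X X'' f g w hg hf
    obtain ⟨hf⟩ := hf
    have hmono : Mono f := mono_of_isLimit_fork hf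
    obtain ⟨a, rfl⟩ := UltraCat.mkHom_surj U f
    obtain ⟨b, rfl⟩ := UltraCat.mkHom_surj U g
    have hw := w
    rw [UltraCat.mkHom_comp, UltraCat.mkHom_eq_zero_iff] at hw
    have h1 : {i | cokernel.π (b i) = 0} ∈ U := by
      let Q : UltraCat U A := fun i => cokernel (b i)
      let p : X'' ⟶ Q := UltraCat.mkHom U (fun i => cokernel.π (b i))
      have : p = 0 := by
        rw [← cancel_epi (UltraCat.mkHom U b), comp_zero]
        refine (UltraCat.mkHom_eq_zero_iff U (X := X) (Y := Q) _).2 ?_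
        exact Filter.univ_mem' fun i => cokernel.condition (b i)
      exact (UltraCat.mkHom_eq_zero_iff U (X := X'') (Y := Q) _).1 this
    have h2 : {i | kernel.ι (a i) = 0} ∈ U := by
      let Q : UltraCat U A := fun i => kernel (a i)
      let p : Q ⟶ X' := UltraCat.mkHom U (fun i => kernel.ι (a i))
      have : p = 0 := by
        rw [← cancel_mono (UltraCat.mkHom U a), zero_comp]
        refine (UltraCat.mkHom_eq_zero_iff U (X := Q) (Y := X) _).2 ?_
        exact Filter.univ_mem' fun i => kernel.condition (a i)
      exact (UltraCat.mkHom_eq_zero_iff U (X := Q) (Y := X') _).1 this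
    obtain ⟨l, h3⟩ : ∃ l : ∀ i, kernel (b i) ⟶ X' i,
        {i | l i ≫ a i = kernel.ι (b i)} ∈ U := by
      let Q : UltraCat U A := fun i => kernel (b i)
      let p : Q ⟶ X := UltraCat.mkHom U (fun i => kernel.ι (b i))
      have hp : p ≫ UltraCat.mkHom U b = 0 := by
        refine (UltraCat.mkHom_eq_zero_iff U (X := Q) (Y := X'') _).2 ?_
        exact Filter.univ_mem' fun i => kernel.condition (b i)
      obtain ⟨l, hl⟩ := KernelFork.IsLimit.lift' hf p hp
      obtain ⟨l, rfl⟩ := UltraCat.mkHom_surj U l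
      exact ⟨l, (UltraCat.mkHom_eq_iff U (X := Q) (Y := X) _ _).1 hl⟩
    have key : {i | B i (X i) ↔ B i (X' i) ∧ B i (X'' i)} ∈ U := by
      filter_upwards [hw, h1, h2, h3] with i hw h1 h2 h3
      have e : Epi (b i) := Preadditive.epi_of_cokernel_zero h1
      have m : Mono (a i) := Preadditive.mono_of_kernel_zero h2
      refine (hB i).2 (a i) (b i) hw e ⟨KernelFork.IsLimit.ofι' (a i) hw fun k hk =>
        ⟨kernel.lift (b i) k hk ≫ l i, ?_⟩⟩
      have h3' : l i ≫ a i = kernel.ι (b i) := h3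
      rw [Category.assoc, h3', kernel.lift_ι]
    constructor
    · intro h
      constructor
      · filter_upwards [key, h] with i hk h using (hk.1 h).1
      · filter_upwards [key, h] with i hk h using (hk.1 h).2
    · rintro ⟨h, h'⟩
      filter_upwards [key, h, h'] with i hk h h' using hk.2 ⟨h, h'⟩
end
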